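/- With P₁ = ℝ^d × {0}, P₂ = {(x,xa+b)}, flat measures μᵢ = cᵢ μ_{Pᵢ} with c₂ ≤ c₁, both intersecting B(x₀,r/2), x₀ ∈ B(0,r/2): if |a| ≤ 1 then dist_{x₀,r}(μ₁,μ₂) ≥ C⁻¹ [ c₁(|a| + |b|/r) + (c₁−c₂) ], and if |a| ≥ 1 then dist_{x₀,r}(μ₁,μ₂) ≥ C⁻¹ c₁, for C depending only on n, d. -/

import Mathlib

open MeasureTheory Metric Set

noncomputable section

/-- `Lip x r`: the set of 1-Lipschitz functions supported in the closed ball `B̄(x,r)`. -/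
def LipIn {E : Type*} [NormedAddCommGroup E] (x : E) (r : ℝ) : Set (E → ℝ) :=
  {f | LipschitzWith 1 f ∧ ∀ y ∉ closedBall x r, f y = 0}

/-- Normalized Wasserstein distance `dist_{x,r}(μ,ν)`. -/
def wdist {E : Type*} [NormedAddCommGroup E] [MeasurableSpace E] (d : ℕ) (x : E) (r : ℝ)
    (μ ν : Measure E) : ℝ :=
  r ^ (-(d : ℝ) - 1) * ⨆ f : LipIn x r, |∫ y, f.1 y ∂μ - ∫ y, f.1 y ∂ν|

/-- The graph `{(x, xa+b)} ⊂ ℝ^{d+m}` of the affine map `x ↦ xa + b`. -/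
def graphPlane (d m : ℕ) (a : Fin d → Fin m → ℝ) (b : Fin m → ℝ) :
    Set (EuclideanSpace ℝ (Fin (d + m))) :=
  {X | ∀ j : Fin m, X (Fin.natAdd d j) = (∑ i, a i j * X (Fin.castAdd m i)) + b j}

/-- A (Frobenius) matrix norm. -/
def matNorm {d m : ℕ} (a : Fin d → Fin m → ℝ) : ℝ :=
  Real.sqrt (∑ i, ∑ j, (a i j) ^ 2)

/-- Euclidean norm of a vector of `ℝ^m`. -/
def vecNorm {m : ℕ} (b : Fin m → ℝ) : ℝ :=
  Real.sqrt (∑ j, (b j) ^ 2)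

/-- The linear map `x ↦ xa`, between Euclidean spaces. -/
def rowAct {d m : ℕ} (a : Fin d → Fin m → ℝ) (x : EuclideanSpace ℝ (Fin d)) :
    EuclideanSpace ℝ (Fin m) :=
  WithLp.toLp 2 fun j => ∑ i, a i j * x i

/-- The parametrization `x ↦ (x, xa+b)` of `graphPlane d m a b`. -/
def graphMap {d m : ℕ} (a : Fin d → Fin m → ℝ) (b : Fin m → ℝ) (x : EuclideanSpace ℝ (Fin d)) :
    EuclideanSpace ℝ (Fin (d + m)) :=
  WithLp.toLp 2 (Fin.append x fun j => (∑ i, a i j * x i) + b j)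

section Euclidean

variable {d m : ℕ} (a : Fin d → Fin m → ℝ) (b : Fin m → ℝ)

lemma rowAct_add (x y : EuclideanSpace ℝ (Fin d)) :
    rowAct a (x + y) = rowAct a x + rowAct a y := by
  ext j; simp [rowAct, mul_add, Finset.sum_add_distrib]

lemma rowAct_sub (x y : EuclideanSpace ℝ (Fin d)) :
    rowAct a (x - y) = rowAct a x - rowAct a y := by
  ext j; simp [rowAct, mul_sub, Finset.sum_sub_distrib]

lemma rowAct_smul (t : ℝ) (x : EuclideanSpace ℝ (Fin d)) :
    rowAct a (t • x) = t • rowAct a x := by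
  ext j; simp [rowAct, Finset.mul_sum, mul_left_comm]

lemma matNorm_nonneg : 0 ≤ matNorm a := Real.sqrt_nonneg _

lemma matNorm_sq : matNorm a ^ 2 = ∑ i, ∑ j, a i j ^ 2 :=
  Real.sq_sqrt (Finset.sum_nonneg fun _ _ => Finset.sum_nonneg fun _ _ => sq_nonneg _)

lemma vecNorm_eq : vecNorm b = ‖WithLp.toLp 2 b‖ := by
  simp [vecNorm, EuclideanSpace.norm_eq]

lemma norm_rowAct_le (x : EuclideanSpace ℝ (Fin d)) : ‖rowAct a x‖ ≤ matNorm a * ‖x‖ := by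
  refine le_of_sq_le_sq ?_ (mul_nonneg (matNorm_nonneg a) (norm_nonneg x))
  rw [mul_pow, matNorm_sq, EuclideanSpace.real_norm_sq_eq, EuclideanSpace.real_norm_sq_eq,
    Finset.sum_comm, Finset.sum_mul]
  exact Finset.sum_le_sum fun j _ => Finset.sum_mul_sq_le_sq_mul_sq Finset.univ (a · j) x

lemma exists_matNorm_le (hd : 0 < d) :
    ∃ i, matNorm a ≤ d * ‖rowAct a (EuclideanSpace.single i 1)‖ := by
  have : Nonempty (Fin d) := ⟨⟨0, hd⟩⟩
  have hd1 : (1 : ℝ) ≤ d := by exact_mod_cast hd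
  have hrow (i : Fin d) : ‖rowAct a (EuclideanSpace.single i 1)‖ ^ 2 = ∑ j, a i j ^ 2 := by
    simp [EuclideanSpace.real_norm_sq_eq, rowAct]
  obtain ⟨i, -, hi⟩ := Finset.exists_le_of_sum_le (s := Finset.univ)
    (f := fun _ : Fin d => matNorm a ^ 2 / d) (g := fun i => ∑ j, a i j ^ 2)
    Finset.univ_nonempty (by
      rw [← matNorm_sq, Finset.sum_const, Finset.card_univ, Fintype.card_fin, nsmul_eq_mul,
        mul_div_cancel₀ _ (by positivity)])
  refine ⟨i, le_of_sq_le_sq ?_ (by positivity)⟩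
  rw [div_le_iff₀ (by positivity), ← hrow] at hi
  rw [mul_pow]
  nlinarith [sq_nonneg ‖rowAct a (EuclideanSpace.single i 1)‖]

lemma norm_graphMap_sub_sq (a' : Fin d → Fin m → ℝ) (b' : Fin m → ℝ)
    (x y : EuclideanSpace ℝ (Fin d)) :
    ‖graphMap a b x - graphMap a' b' y‖ ^ 2 = ‖x - y‖ ^ 2 +
      ‖(rowAct a x + WithLp.toLp 2 b) - (rowAct a' y + WithLp.toLp 2 b')‖ ^ 2 := by
  simp [EuclideanSpace.real_norm_sq_eq, Fin.sum_univ_add, graphMap, rowAct]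

lemma norm_sub_le_graphMap (a' : Fin d → Fin m → ℝ) (b' : Fin m → ℝ)
    (x y : EuclideanSpace ℝ (Fin d)) :
    ‖x - y‖ ≤ ‖graphMap a b x - graphMap a' b' y‖ := by
  refine le_of_sq_le_sq ?_ (norm_nonneg _)
  rw [norm_graphMap_sub_sq]
  exact le_add_of_nonneg_right (sq_nonneg _)

lemma norm_rowAct_sub_le_graphMap (a' : Fin d → Fin m → ℝ) (b' : Fin m → ℝ)
    (x y : EuclideanSpace ℝ (Fin d)) :
    ‖(rowAct a x + WithLp.toLp 2 b) - (rowAct a' y + WithLp.toLp 2 b')‖ ≤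
      ‖graphMap a b x - graphMap a' b' y‖ := by
  refine le_of_sq_le_sq ?_ (norm_nonneg _)
  rw [norm_graphMap_sub_sq]
  exact le_add_of_nonneg_left (sq_nonneg _)

lemma rowAct_zero (x : EuclideanSpace ℝ (Fin d)) :
    rowAct (0 : Fin d → Fin m → ℝ) x = 0 := by
  ext j; simp [rowAct]

lemma graphMap_zero_zero : graphMap (0 : Fin d → Fin m → ℝ) 0 0 = 0 := by
  ext k
  refine Fin.addCases (fun i => ?_) (fun j => ?_) k <;> simp [graphMap]

lemma isometry_graphMap_zero :
    Isometry (graphMap (0 : Fin d → Fin m → ℝ) 0) := by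
  refine Isometry.of_dist_eq fun x y => ?_
  rw [dist_eq_norm, dist_eq_norm, ← sq_eq_sq₀ (norm_nonneg _) (norm_nonneg _),
    norm_graphMap_sub_sq]
  simp [rowAct_zero]

lemma lipschitzWith_graphMap :
    LipschitzWith (1 + matNorm a).toNNReal (graphMap a b) := by
  have hA := matNorm_nonneg a
  refine LipschitzWith.of_dist_le_mul fun x y => ?_
  rw [Real.coe_toNNReal _ (by positivity), dist_eq_norm, dist_eq_norm]
  refine le_of_sq_le_sq ?_ (by positivity)
  have h := norm_rowAct_le a (x - y)
  rw [norm_graphMap_sub_sq, add_sub_add_right_eq_sub, ← rowAct_sub]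
  nlinarith [norm_nonneg (rowAct a (x - y)), mul_nonneg hA (sq_nonneg ‖x - y‖),
    mul_self_le_mul_self (norm_nonneg _) h]

lemma range_graphMap : range (graphMap a b) = graphPlane d m a b := by
  ext X
  constructor
  · rintro ⟨x, rfl⟩ j
    simp [graphMap]
  · intro hX
    refine ⟨WithLp.toLp 2 fun i => X (Fin.castAdd m i), ?_⟩
    ext k
    refine Fin.addCases (fun i => ?_) (fun j => ?_) k
    · simp [graphMap]
    · simp [graphMap, hX j]

/-- A point of `ℝ^d × {0}` is far from the graph as soon as the affine map is large there. -/
lemma norm_rowAct_add_le (x z : EuclideanSpace ℝ (Fin d)) :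
    ‖rowAct a x + WithLp.toLp 2 b‖ ≤
      (1 + matNorm a) * ‖graphMap 0 0 x - graphMap a b z‖ := by
  have h1 := norm_sub_le_graphMap (0 : Fin d → Fin m → ℝ) 0 a b x z
  have h2 := norm_rowAct_sub_le_graphMap (0 : Fin d → Fin m → ℝ) 0 a b x z
  rw [rowAct_zero, WithLp.toLp_zero, add_zero, zero_sub, norm_neg] at h2
  have h3 := norm_rowAct_le a (x - z)
  have h4 : rowAct a x + WithLp.toLp 2 b =
      (rowAct a z + WithLp.toLp 2 b) + rowAct a (x - z) := by
    rw [rowAct_sub]; abel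
  have h5 := mul_le_mul_of_nonneg_left h1 (matNorm_nonneg a)
  rw [h4]
  linarith [norm_add_le (rowAct a z + WithLp.toLp 2 b) (rowAct a (x - z))]

end Euclidean

section Flat

variable {d m : ℕ} (a : Fin d → Fin m → ℝ) (b : Fin m → ℝ)

instance : (μH[(d : ℝ)] : Measure (EuclideanSpace ℝ (Fin d))).IsAddHaarMeasure := by
  have := isAddHaarMeasure_hausdorffMeasure (E := EuclideanSpace ℝ (Fin d))
  rwa [finrank_euclideanSpace_fin] at this

lemma hausdorffMeasure_real_ball (x : EuclideanSpace ℝ (Fin d)) {ρ : ℝ} (hρ : 0 < ρ) :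
    (μH[(d : ℝ)]).real (ball x ρ) =
      ρ ^ d * (μH[(d : ℝ)] : Measure (EuclideanSpace ℝ (Fin d))).real (ball 0 1) := by
  rw [Measure.real, Measure.addHaar_ball_of_pos _ _ hρ, finrank_euclideanSpace_fin,
    ENNReal.toReal_mul, ENNReal.toReal_ofReal (by positivity), Measure.real]

lemma restrict_graphPlane_zero :
    (μH[(d : ℝ)]).restrict (graphPlane d m 0 0) =
      (μH[(d : ℝ)]).map (graphMap (0 : Fin d → Fin m → ℝ) 0) := by
  rw [isometry_graphMap_zero.map_hausdorffMeasure (Or.inl (Nat.cast_nonneg d)), range_graphMap]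

lemma measurableEmbedding_graphMap_zero :
    MeasurableEmbedding (graphMap (0 : Fin d → Fin m → ℝ) 0) :=
  isometry_graphMap_zero.isClosedEmbedding.measurableEmbedding

lemma restrict_graphPlane_le :
    (μH[(d : ℝ)]).restrict (graphPlane d m a b) ≤
      ENNReal.ofReal ((1 + matNorm a) ^ d) • (μH[(d : ℝ)]).map (graphMap a b) := by
  have hcont := (lipschitzWith_graphMap a b).continuous
  refine Measure.le_intro fun s hs _ => ?_
  rw [Measure.restrict_apply hs, Measure.smul_apply, Measure.map_apply hcont.measurable hs,
    ← range_graphMap, ← image_preimage_eq_inter_range, smul_eq_mul]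
  refine ((lipschitzWith_graphMap a b).hausdorffMeasure_image_le (Nat.cast_nonneg d) _).trans ?_
  have hA := matNorm_nonneg a
  rw [ENNReal.rpow_natCast, ENNReal.ofReal_pow (by positivity)]
  rfl

lemma restrict_graphPlane_closedBall_lt_top (x₀ : EuclideanSpace ℝ (Fin (d + m))) (r : ℝ) :
    (μH[(d : ℝ)]).restrict (graphPlane d m a b) (closedBall x₀ r) < ⊤ := by
  have hcont := (lipschitzWith_graphMap a b).continuous
  refine (restrict_graphPlane_le a b _).trans_lt ?_
  rw [Measure.smul_apply, Measure.map_apply hcont.measurable measurableSet_closedBall]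
  refine ENNReal.mul_lt_top ENNReal.ofReal_lt_top ?_
  refine Bornology.IsBounded.measure_lt_top (isBounded_iff.2 ⟨r + r, fun x hx y hy => ?_⟩)
  have h := norm_sub_le_graphMap a b a b x y
  rw [← dist_eq_norm, ← dist_eq_norm] at h
  exact h.trans (dist_triangle_right _ _ x₀ |>.trans (add_le_add hx hy))

end Flat

section Wasserstein

variable {E : Type*} [NormedAddCommGroup E]

/-- The tent function of height and radius `R` centred at `p`. -/
def tent (p : E) (R : ℝ) (y : E) : ℝ := max (R - dist y p) 0

lemma tent_nonneg (p : E) (R : ℝ) (y : E) : 0 ≤ tent p R y := le_max_right _ _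

lemma tent_mem_LipIn {p x : E} {R r : ℝ} (h : closedBall p R ⊆ closedBall x r) :
    tent p R ∈ LipIn x r := by
  refine ⟨?_, fun y hy => max_eq_right ?_⟩
  · refine LipschitzWith.max_const (LipschitzWith.of_le_add fun y z => ?_) 0
    linarith [dist_triangle_left z p y, dist_comm y z]
  · have : R < dist y p := by simpa using fun hy' => hy (h hy')
    linarith

lemma min_infDist_tent_mem_LipIn {p x : E} {R r : ℝ} (h : closedBall p R ⊆ closedBall x r)
    (S : Set E) : (fun y => min (infDist y S) (tent p R y)) ∈ LipIn x r := by
  refine ⟨?_, fun y hy => ?_⟩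
  · simpa using (lipschitz_infDist_pt S).min (tent_mem_LipIn h).1
  · simp [(tent_mem_LipIn h).2 y hy, infDist_nonneg]

variable [NormedSpace ℝ E] [Nontrivial E]

lemma abs_le_of_mem_LipIn {x : E} {r : ℝ} (hr : 0 < r) {f : E → ℝ} (hf : f ∈ LipIn x r) (y : E)
    (hy : y ∈ closedBall x r) : |f y| ≤ 3 * r := by
  obtain ⟨v, hv⟩ := exists_norm_eq E (c := 2 * r) (by positivity)
  have h0 : f (x + v) = 0 := hf.2 _ (by simp [hv]; linarith)
  have h1 := hf.1.dist_le_mul y (x + v)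
  rw [h0, Real.dist_eq, sub_zero, NNReal.coe_one, one_mul] at h1
  have h2 : dist x (x + v) = 2 * r := by simp [hv]
  linarith [dist_triangle y x (x + v), mem_closedBall.1 hy]

variable [MeasurableSpace E]

lemma abs_integral_le_of_mem_LipIn {x : E} {r : ℝ} (hr : 0 < r) {f : E → ℝ} (hf : f ∈ LipIn x r)
    {μ : Measure E} (hμ : μ (closedBall x r) < ⊤) :
    |∫ y, f y ∂μ| ≤ 3 * r * μ.real (closedBall x r) := by
  rw [← setIntegral_eq_integral_of_forall_compl_eq_zero (hf.2)]
  exact norm_setIntegral_le_of_norm_le_const hμ fun y hy => (Real.norm_eq_abs _).trans_le (abs_le_of_mem_LipIn hr hf y hy)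

lemma abs_integral_sub_le_wdist (d : ℕ) {x : E} {r : ℝ} (hr : 0 < r) {f : E → ℝ}
    (hf : f ∈ LipIn x r) {μ ν : Measure E} (hμ : μ (closedBall x r) < ⊤)
    (hν : ν (closedBall x r) < ⊤) :
    |∫ y, f y ∂μ - ∫ y, f y ∂ν| ≤ r ^ (d + 1) * wdist d x r μ ν := by
  have hb : BddAbove (range fun f : LipIn x r => |∫ y, f.1 y ∂μ - ∫ y, f.1 y ∂ν|) := by
    refine ⟨3 * r * μ.real (closedBall x r) + 3 * r * ν.real (closedBall x r), ?_⟩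
    rintro _ ⟨g, rfl⟩
    exact (abs_sub _ _).trans (add_le_add (abs_integral_le_of_mem_LipIn hr g.2 hμ)
      (abs_integral_le_of_mem_LipIn hr g.2 hν))
  have hpow : r ^ (d + 1) * r ^ (-(d : ℝ) - 1) = 1 := by
    rw [← Real.rpow_natCast, ← Real.rpow_add hr]
    simp
  rw [wdist, ← mul_assoc, hpow, one_mul]
  exact le_ciSup hb ⟨f, hf⟩

variable [BorelSpace E]

lemma integrable_of_mem_LipIn {x : E} {r : ℝ} (hr : 0 < r) {f : E → ℝ} (hf : f ∈ LipIn x r)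
    {μ : Measure E} (hμ : μ (closedBall x r) < ⊤) : Integrable f μ := by
  rw [← integrableOn_iff_integrable_of_support_subset (s := closedBall x r)
    (fun y hy => by_contra fun h => hy (hf.2 y h))]
  have : IsFiniteMeasure (μ.restrict (closedBall x r)) := ⟨by simpa using hμ⟩
  refine Integrable.of_bound hf.1.continuous.measurable.aestronglyMeasurable (3 * r) ?_
  exact (ae_restrict_iff' measurableSet_closedBall).2
    (ae_of_all _ fun y hy => abs_le_of_mem_LipIn hr hf y hy)

end Wasserstein

section Testing

variable {d m : ℕ} {a : Fin d → Fin m → ℝ} {b : Fin m → ℝ}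
  {x₀ : EuclideanSpace ℝ (Fin (d + m))} {r c₁ c₂ : ℝ}

/-- The flat measure of density `c` on `graphPlane d m a b`. -/
def flatMeasure (c : ℝ) (a : Fin d → Fin m → ℝ) (b : Fin m → ℝ) :
    Measure (EuclideanSpace ℝ (Fin (d + m))) :=
  ENNReal.ofReal c • (μH[(d : ℝ)]).restrict (graphPlane d m a b)

/-- The `d`-dimensional Hausdorff measure of the unit ball of `ℝ^d`. -/
def unitBallMeasure (d : ℕ) : ℝ :=
  (μH[(d : ℝ)] : Measure (EuclideanSpace ℝ (Fin d))).real (ball 0 1)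

lemma unitBallMeasure_pos : 0 < unitBallMeasure d :=
  ENNReal.toReal_pos (measure_ball_pos _ _ one_pos).ne' measure_ball_lt_top.ne

lemma flatMeasure_closedBall_lt_top (c : ℝ) : flatMeasure c a b (closedBall x₀ r) < ⊤ :=
  ENNReal.mul_lt_top ENNReal.ofReal_lt_top (restrict_graphPlane_closedBall_lt_top a b x₀ r)

lemma integral_flatMeasure_zero (hc : 0 ≤ c₁) (f : EuclideanSpace ℝ (Fin (d + m)) → ℝ) :
    ∫ y, f y ∂flatMeasure c₁ (0 : Fin d → Fin m → ℝ) 0 =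
      c₁ * ∫ x, f (graphMap 0 0 x) ∂μH[(d : ℝ)] := by
  rw [flatMeasure, integral_smul_measure, restrict_graphPlane_zero,
    measurableEmbedding_graphMap_zero.integral_map, ENNReal.toReal_ofReal hc, smul_eq_mul]

lemma nontrivial_euclideanSpace (hd : 0 < d) :
    Nontrivial (EuclideanSpace ℝ (Fin (d + m))) := by
  have : Nonempty (Fin (d + m)) := ⟨⟨0, by omega⟩⟩
  infer_instance

lemma integrable_comp_graphMap (hd : 0 < d) (hr : 0 < r)
    {f : EuclideanSpace ℝ (Fin (d + m)) → ℝ} (hf : f ∈ LipIn x₀ r) :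
    Integrable (fun x => f (graphMap (0 : Fin d → Fin m → ℝ) 0 x)) μH[(d : ℝ)] := by
  have := nontrivial_euclideanSpace (m := m) hd
  rw [← Function.comp_def, ← measurableEmbedding_graphMap_zero.integrable_map_iff,
    ← restrict_graphPlane_zero]
  exact integrable_of_mem_LipIn hr hf (restrict_graphPlane_closedBall_lt_top 0 0 x₀ r)

lemma le_integral_comp_graphMap (hd : 0 < d) (hr : 0 < r)
    {f : EuclideanSpace ℝ (Fin (d + m)) → ℝ} (hf : f ∈ LipIn x₀ r) (hf0 : ∀ y, 0 ≤ f y)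
    {q : EuclideanSpace ℝ (Fin d)} {ρ η : ℝ} (hρ : 0 < ρ)
    (h : ∀ x ∈ ball q ρ, η ≤ f (graphMap (0 : Fin d → Fin m → ℝ) 0 x)) :
    η * (ρ ^ d * unitBallMeasure d) ≤
      ∫ x, f (graphMap (0 : Fin d → Fin m → ℝ) 0 x) ∂μH[(d : ℝ)] := by
  have hint := integrable_comp_graphMap hd hr hf
  refine le_trans ?_ (setIntegral_le_integral hint (s := ball q ρ) (ae_of_all _ fun x => hf0 _))
  refine le_trans (le_of_eq ?_) (setIntegral_mono_on (f := fun _ => η)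
    (integrableOn_const measure_ball_lt_top.ne) hint.integrableOn measurableSet_ball h)
  rw [setIntegral_const, hausdorffMeasure_real_ball q hρ, smul_eq_mul, unitBallMeasure, mul_comm]

/-- Testing against `min (dist(·, P₂)) tent`, which vanishes on `P₂`. -/
lemma le_wdist_of_separated (hd : 0 < d) (hr : 0 < r) (hc : 0 ≤ c₁)
    {q : EuclideanSpace ℝ (Fin d)} {R η : ℝ} (hR : 0 < R)
    (hq : closedBall (graphMap 0 0 q) R ⊆ closedBall x₀ r) (hη : η ≤ R / 2)
    (h : ∀ x ∈ ball q (R / 2), (1 + matNorm a) * η ≤ ‖rowAct a x + WithLp.toLp 2 b‖) :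
    c₁ * (η * ((R / 2) ^ d * unitBallMeasure d)) ≤
      r ^ (d + 1) * wdist d x₀ r (flatMeasure c₁ 0 0) (flatMeasure c₂ a b) := by
  have := nontrivial_euclideanSpace (m := m) hd
  have hf := min_infDist_tent_mem_LipIn hq (graphPlane d m a b)
  set f := fun y => min (infDist y (graphPlane d m a b)) (tent (graphMap 0 0 q) R y) with hfdef
  have h2 : ∫ y, f y ∂flatMeasure c₂ a b = 0 := by
    rw [flatMeasure, integral_smul_measure, setIntegral_eq_zero_of_forall_eq_zero, smul_zero]
    intro y hy
    simp [hfdef, infDist_zero_of_mem hy, tent_nonneg]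
  have h1 := abs_integral_sub_le_wdist d hr hf
    (flatMeasure_closedBall_lt_top (a := 0) (b := 0) c₁)
    (flatMeasure_closedBall_lt_top (a := a) (b := b) c₂)
  rw [h2, sub_zero, integral_flatMeasure_zero hc] at h1
  refine le_trans (mul_le_mul_of_nonneg_left ?_ hc) ((le_abs_self _).trans h1)
  refine le_integral_comp_graphMap (q := q) hd hr hf
    (fun y => le_min infDist_nonneg (tent_nonneg _ _ _)) (half_pos hR) fun x hx => le_min ?_ ?_
  · rw [← range_graphMap]
    refine (le_infDist (range_nonempty _)).2 ?_
    rintro _ ⟨z, rfl⟩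
    rw [dist_eq_norm]
    have hA := matNorm_nonneg a
    exact le_of_mul_le_mul_left ((h x hx).trans (norm_rowAct_add_le a b x z)) (by positivity)
  · refine le_max_of_le_left ?_
    rw [isometry_graphMap_zero.dist_eq]
    linarith [mem_ball.1 hx]

/-- Testing against a tent centred on `P₁`, whose integral grows by at most the area factor
`(1 + |a|)^d` when passing from `P₁` to `P₂`. -/
lemma density_sub_le_wdist (hd : 0 < d) (hr : 0 < r) (hc₁ : 0 ≤ c₁) (hc₂ : 0 ≤ c₂)
    {q : EuclideanSpace ℝ (Fin d)} {R : ℝ} (hR : 0 < R)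
    (hq : closedBall (graphMap 0 0 q) R ⊆ closedBall x₀ r) :
    (c₁ - c₂ * (1 + matNorm a) ^ d) * (R / 2 * ((R / 2) ^ d * unitBallMeasure d)) ≤
      r ^ (d + 1) * wdist d x₀ r (flatMeasure c₁ 0 0) (flatMeasure c₂ a b) := by
  have := nontrivial_euclideanSpace (m := m) hd
  have hA := matNorm_nonneg a
  have hf := tent_mem_LipIn hq
  have h1 := abs_integral_sub_le_wdist d hr hf
    (flatMeasure_closedBall_lt_top (a := 0) (b := 0) c₁)
    (flatMeasure_closedBall_lt_top (a := a) (b := b) c₂)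
  have h0 := (abs_nonneg _).trans h1
  rcases le_total (c₁ - c₂ * (1 + matNorm a) ^ d) 0 with hneg | hpos
  · have := unitBallMeasure_pos (d := d)
    exact (mul_nonpos_of_nonpos_of_nonneg hneg (by positivity)).trans h0
  have hT : R / 2 * ((R / 2) ^ d * unitBallMeasure d) ≤
      ∫ x, tent (graphMap 0 0 q) R (graphMap (0 : Fin d → Fin m → ℝ) 0 x) ∂μH[(d : ℝ)] := by
    refine le_integral_comp_graphMap (q := q) hd hr hf (tent_nonneg _ _) (half_pos hR) fun x hx => ?_
    refine le_max_of_le_left ?_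
    rw [isometry_graphMap_zero.dist_eq]
    linarith [mem_ball.1 hx]
  set T := ∫ x, tent (graphMap 0 0 q) R (graphMap (0 : Fin d → Fin m → ℝ) 0 x) ∂μH[(d : ℝ)]
  have hcont := (lipschitzWith_graphMap a b).continuous
  have hle (x : EuclideanSpace ℝ (Fin d)) : tent (graphMap 0 0 q) R (graphMap a b x) ≤
      tent (graphMap 0 0 q) R (graphMap (0 : Fin d → Fin m → ℝ) 0 x) := by
    refine max_le_max_right 0 (sub_le_sub_left ?_ _)
    rw [isometry_graphMap_zero.dist_eq, dist_eq_norm, dist_eq_norm]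
    exact norm_sub_le_graphMap _ _ _ _ _ _
  have hintT := integrable_comp_graphMap hd hr hf
  have hint : Integrable (fun x => tent (graphMap 0 0 q) R (graphMap a b x)) μH[(d : ℝ)] :=
    hintT.mono' (hf.1.continuous.comp hcont).aestronglyMeasurable
      (ae_of_all _ fun x => by
        rw [Real.norm_of_nonneg (tent_nonneg _ _ _)]
        exact hle x)
  have h2 : ∫ y, tent (graphMap 0 0 q) R y ∂flatMeasure c₂ a b ≤
      c₂ * ((1 + matNorm a) ^ d * T) := by
    rw [flatMeasure, integral_smul_measure, ENNReal.toReal_ofReal hc₂, smul_eq_mul]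
    refine mul_le_mul_of_nonneg_left ?_ hc₂
    have hmeas := hf.1.continuous.aestronglyMeasurable
      (μ := (μH[(d : ℝ)] : Measure (EuclideanSpace ℝ (Fin d))).map (graphMap a b))
    refine (integral_mono_measure (restrict_graphPlane_le a b)
      (ae_of_all _ (tent_nonneg _ _)) ?_).trans ?_
    · refine Integrable.smul_measure ?_ ENNReal.ofReal_ne_top
      exact (integrable_map_measure hmeas hcont.aemeasurable).2 hint
    · rw [integral_smul_measure, integral_map hcont.aemeasurable hmeas,
        ENNReal.toReal_ofReal (by positivity), smul_eq_mul]
      exact mul_le_mul_of_nonneg_left (integral_mono hint hintT hle) (by positivity)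
  rw [integral_flatMeasure_zero hc₁] at h1
  calc _ ≤ (c₁ - c₂ * (1 + matNorm a) ^ d) * T := mul_le_mul_of_nonneg_left hT hpos
    _ = c₁ * T - c₂ * ((1 + matNorm a) ^ d * T) := by ring
    _ ≤ _ := (sub_le_sub_left h2 _).trans ((le_abs_self _).trans h1)

end Testing

section Estimates

variable {d m : ℕ} {a : Fin d → Fin m → ℝ} {b : Fin m → ℝ}
  {x₀ : EuclideanSpace ℝ (Fin (d + m))} {r c₁ c₂ : ℝ} {p : EuclideanSpace ℝ (Fin d)}

/-- The dimensional constant of the lower bounds. -/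
def lowerConst (d : ℕ) : ℝ := unitBallMeasure d / (8 * d) ^ (d + 1)

lemma lowerConst_pos (hd : 0 < d) : 0 < lowerConst d := by
  have := unitBallMeasure_pos (d := d)
  unfold lowerConst
  positivity

lemma lowerConst_le (hd : 0 < d) : lowerConst d ≤ unitBallMeasure d / 8 ^ (d + 1) := by
  have := unitBallMeasure_pos (d := d)
  have hd1 : (1 : ℝ) ≤ d := by exact_mod_cast hd
  unfold lowerConst
  gcongr
  linarith

lemma closedBall_graphMap_subset (hp : graphMap (0 : Fin d → Fin m → ℝ) 0 p ∈ ball x₀ (r / 2))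
    {q : EuclideanSpace ℝ (Fin d)} {R : ℝ} (h : R + dist q p ≤ r / 2) :
    closedBall (graphMap (0 : Fin d → Fin m → ℝ) 0 q) R ⊆ closedBall x₀ r := by
  refine closedBall_subset_closedBall' ?_
  have h1 := dist_triangle (graphMap (0 : Fin d → Fin m → ℝ) 0 q) (graphMap 0 0 p) x₀
  rw [isometry_graphMap_zero.dist_eq] at h1
  linarith [mem_ball.1 hp]

/-- An affine map is large near one of two well-chosen points of any ball. -/
lemma exists_norm_rowAct_add_ge (hd : 0 < d) (hr : 0 < r) (p : EuclideanSpace ℝ (Fin d)) :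
    ∃ q, dist q p = r / 4 ∧
      ∀ x ∈ ball q (r / (8 * d)), r * matNorm a / (8 * d) ≤ ‖rowAct a x + WithLp.toLp 2 b‖ := by
  have hd1 : (0 : ℝ) < d := by exact_mod_cast hd
  have hA := matNorm_nonneg a
  obtain ⟨i, hi⟩ := exists_matNorm_le a hd
  set e : EuclideanSpace ℝ (Fin d) := EuclideanSpace.single i 1 with he
  have hne : ‖e‖ = 1 := by simp [he]
  suffices H : ∃ q, dist q p = r / 4 ∧
      r * matNorm a / (4 * d) ≤ ‖rowAct a q + WithLp.toLp 2 b‖ by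
    obtain ⟨q, hq, hqa⟩ := H
    refine ⟨q, hq, fun x hx => ?_⟩
    have h1 : rowAct a q + WithLp.toLp 2 b =
        (rowAct a x + WithLp.toLp 2 b) + rowAct a (q - x) := by rw [rowAct_sub]; abel
    have h2 := norm_add_le (rowAct a x + WithLp.toLp 2 b) (rowAct a (q - x))
    have h3 := norm_rowAct_le a (q - x)
    have h4 : ‖q - x‖ ≤ r / (8 * d) := by
      rw [← dist_eq_norm, dist_comm]; exact (mem_ball.1 hx).le
    have h5 := mul_le_mul_of_nonneg_left h4 hA
    have h6 : r * matNorm a / (4 * d) =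
        r * matNorm a / (8 * d) + matNorm a * (r / (8 * d)) := by field_simp; ring
    rw [← h1] at h2
    linarith
  by_contra! H
  have h1 := H (p + (r / 4) • e) (by simp [norm_smul, hne, abs_of_pos hr])
  have h2 := H (p - (r / 4) • e) (by simp [norm_smul, hne, abs_of_pos hr])
  have h3 : (r / 2) • rowAct a e = (rowAct a (p + (r / 4) • e) + WithLp.toLp 2 b) -
      (rowAct a (p - (r / 4) • e) + WithLp.toLp 2 b) := by
    rw [rowAct_add, rowAct_sub, rowAct_smul]
    module
  have h4 := norm_sub_le (rowAct a (p + (r / 4) • e) + WithLp.toLp 2 b)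
    (rowAct a (p - (r / 4) • e) + WithLp.toLp 2 b)
  rw [← h3, norm_smul, Real.norm_of_nonneg (by positivity)] at h4
  have h5 : r * matNorm a / (4 * d) ≤ r / 4 * ‖rowAct a e‖ := by
    rw [div_le_iff₀ (by positivity)]
    nlinarith
  linarith

lemma mul_matNorm_le_wdist (hd : 0 < d) (hr : 0 < r) (hc : 0 ≤ c₁)
    (hp : graphMap (0 : Fin d → Fin m → ℝ) 0 p ∈ ball x₀ (r / 2)) :
    c₁ * lowerConst d * matNorm a ≤
      (1 + matNorm a) * wdist d x₀ r (flatMeasure c₁ 0 0) (flatMeasure c₂ a b) := by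
  have hd1 : (1 : ℝ) ≤ d := by exact_mod_cast hd
  have hA := matNorm_nonneg a
  obtain ⟨q, hq, hqa⟩ := exists_norm_rowAct_add_ge (a := a) (b := b) hd hr p
  have hR : r / (4 * d) / 2 = r / (8 * d) := by field_simp; norm_num
  have h := le_wdist_of_separated (a := a) (b := b) (c₂ := c₂) (x₀ := x₀) (q := q)
    (R := r / (4 * d)) (η := r * matNorm a / (8 * d) / (1 + matNorm a)) hd hr hc (by positivity)
    (closedBall_graphMap_subset hp (by
      rw [hq]
      have : r / (4 * d) ≤ r / 4 := by gcongr; linarith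
      linarith))
    (by
      rw [hR, div_le_iff₀ (by positivity), div_mul_eq_mul_div]
      gcongr
      linarith)
    (by
      rw [hR, mul_div_cancel₀ _ (by positivity)]
      exact hqa)
  have h1 : c₁ * (r * matNorm a / (8 * d) / (1 + matNorm a) *
      ((r / (4 * d) / 2) ^ d * unitBallMeasure d)) =
      r ^ (d + 1) * (c₁ * lowerConst d * matNorm a / (1 + matNorm a)) := by
    rw [hR, lowerConst, div_pow]
    field_simp
    ring
  rw [h1] at h
  have h2 := le_of_mul_le_mul_left h (by positivity)
  rwa [div_le_iff₀' (by positivity)] at h2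

lemma vecNorm_le (hA1 : matNorm a ≤ 1) (hx₀ : x₀ ∈ ball 0 (r / 2))
    (h : (graphPlane d m a b ∩ ball x₀ (r / 2)).Nonempty) : vecNorm b ≤ 2 * r := by
  obtain ⟨_, hz, hzb⟩ := h
  rw [← range_graphMap] at hz
  obtain ⟨z, rfl⟩ := hz
  have hn : ‖graphMap a b z‖ ≤ r := by
    rw [← dist_zero_right]
    linarith [dist_triangle (graphMap a b z) x₀ 0, mem_ball.1 hzb, mem_ball.1 hx₀]
  have h1 := norm_sub_le_graphMap a b 0 0 z 0
  have h2 := norm_rowAct_sub_le_graphMap a b 0 0 z 0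
  rw [graphMap_zero_zero, sub_zero, sub_zero] at h1
  rw [graphMap_zero_zero, sub_zero, rowAct_zero, WithLp.toLp_zero, add_zero, sub_zero] at h2
  have h3 := norm_sub_le (rowAct a z + WithLp.toLp 2 b) (rowAct a z)
  rw [add_sub_cancel_left, ← vecNorm_eq] at h3
  have h4 := norm_rowAct_le a z
  have h5 : matNorm a * ‖z‖ ≤ 1 * r :=
    mul_le_mul hA1 (h1.trans hn) (norm_nonneg _) zero_le_one
  linarith

lemma mul_vecNorm_le_wdist (hd : 0 < d) (hr : 0 < r) (hc : 0 ≤ c₁) (hA1 : matNorm a ≤ 1)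
    (hp : graphMap (0 : Fin d → Fin m → ℝ) 0 p ∈ ball x₀ (r / 2)) (hx₀ : x₀ ∈ ball 0 (r / 2))
    (h : (graphPlane d m a b ∩ ball x₀ (r / 2)).Nonempty) :
    c₁ * lowerConst d * (vecNorm b / r) ≤
      8 * wdist d x₀ r (flatMeasure c₁ 0 0) (flatMeasure c₂ a b) := by
  have hA := matNorm_nonneg a
  have hB : 0 ≤ vecNorm b := Real.sqrt_nonneg _
  have hk := lowerConst_pos hd
  have hBr := vecNorm_le hA1 hx₀ h
  have hmat := mul_matNorm_le_wdist (a := a) (b := b) (c₂ := c₂) hd hr hc hp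
  have hD : 0 ≤ wdist d x₀ r (flatMeasure c₁ 0 0) (flatMeasure c₂ a b) :=
    nonneg_of_mul_nonneg_right ((by positivity : (0 : ℝ) ≤ _).trans hmat) (by positivity)
  rcases le_or_gt (vecNorm b) (4 * (r * matNorm a)) with hcase | hcase
  · have h1 : vecNorm b / r ≤ 4 * matNorm a := by rw [div_le_iff₀ hr]; linarith
    have h2 := mul_le_mul_of_nonneg_left h1 (mul_nonneg hc hk.le)
    nlinarith
  have hpn : ‖p‖ ≤ r := by
    have h1 := norm_sub_le_graphMap (0 : Fin d → Fin m → ℝ) 0 0 0 p 0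
    rw [graphMap_zero_zero, sub_zero, sub_zero, ← dist_zero_right (graphMap _ _ _)] at h1
    linarith [dist_triangle (graphMap (0 : Fin d → Fin m → ℝ) 0 p) x₀ 0, mem_ball.1 hp,
      mem_ball.1 hx₀]
  have h1 := le_wdist_of_separated (a := a) (b := b) (c₂ := c₂) (x₀ := x₀) (q := p)
    (R := r / 2) (η := vecNorm b / 8) hd hr hc (by positivity)
    (closedBall_graphMap_subset hp (by simp)) (by linarith) (fun x hx => by
      have h2 := norm_sub_le (rowAct a x + WithLp.toLp 2 b) (rowAct a x)
      rw [add_sub_cancel_left, ← vecNorm_eq] at h2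
      have h3 : ‖x‖ ≤ 2 * r := by
        have := norm_le_norm_add_norm_sub' x p
        rw [← dist_eq_norm] at this
        linarith [mem_ball.1 hx]
      have h4 := mul_le_mul_of_nonneg_left h3 hA
      nlinarith [norm_rowAct_le a x])
  have h2 : c₁ * (vecNorm b / 8 * ((r / 2 / 2) ^ d * unitBallMeasure d)) =
      r ^ (d + 1) * (c₁ * (unitBallMeasure d / (4 ^ d * 8)) * (vecNorm b / r)) := by
    rw [div_div, div_pow]
    norm_num
    field_simp
    ring
  rw [h2] at h1
  have h3 := le_of_mul_le_mul_left h1 (by positivity)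
  have h4 : lowerConst d ≤ unitBallMeasure d / (4 ^ d * 8) := by
    have := unitBallMeasure_pos (d := d)
    refine (lowerConst_le hd).trans ?_
    rw [pow_succ]
    gcongr
    norm_num
  have h5 : c₁ * lowerConst d * (vecNorm b / r) ≤
      c₁ * (unitBallMeasure d / (4 ^ d * 8)) * (vecNorm b / r) := by gcongr
  linarith

lemma one_add_pow_le (d : ℕ) {t : ℝ} (h0 : 0 ≤ t) (h1 : t ≤ 1) :
    (1 + t) ^ d ≤ 1 + (2 ^ d - 1) * t := by
  induction d with
  | zero => simp
  | succ n ih =>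
    have : (1 : ℝ) ≤ 2 ^ n := one_le_pow₀ one_le_two
    rw [pow_succ, pow_succ]
    nlinarith [mul_le_mul_of_nonneg_right ih (by linarith : 0 ≤ 1 + t),
      mul_nonneg (sub_nonneg.2 this) (mul_nonneg h0 (sub_nonneg.2 h1))]

lemma mul_sub_le_wdist (hd : 0 < d) (hr : 0 < r) (hc₂ : 0 ≤ c₂) (hc : c₂ ≤ c₁)
    (hA1 : matNorm a ≤ 1)
    (hp : graphMap (0 : Fin d → Fin m → ℝ) 0 p ∈ ball x₀ (r / 2)) :
    lowerConst d * (c₁ - c₂) ≤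
      (1 + 2 ^ (d + 1)) * wdist d x₀ r (flatMeasure c₁ 0 0) (flatMeasure c₂ a b) := by
  have hA := matNorm_nonneg a
  have hk := lowerConst_pos hd
  have hc₁ := hc₂.trans hc
  have hmat := mul_matNorm_le_wdist (a := a) (b := b) (c₂ := c₂) hd hr hc₁ hp
  have hdens := density_sub_le_wdist (a := a) (b := b) (x₀ := x₀) (q := p) (R := r / 2)
    hd hr hc₁ hc₂ (by positivity) (closedBall_graphMap_subset hp (by simp))
  set D := wdist d x₀ r (flatMeasure c₁ 0 0) (flatMeasure c₂ a b)
  have hD : 0 ≤ D :=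
    nonneg_of_mul_nonneg_right ((by positivity : (0 : ℝ) ≤ _).trans hmat) (by positivity)
  have hmat2 : c₁ * lowerConst d * matNorm a ≤ 2 * D := by nlinarith
  have hdens2 : (c₁ - c₂ * (1 + matNorm a) ^ d) * lowerConst d ≤ D := by
    rcases le_total (c₁ - c₂ * (1 + matNorm a) ^ d) 0 with hneg | hpos
    · exact (mul_nonpos_of_nonpos_of_nonneg hneg hk.le).trans hD
    have h1 : r / 2 / 2 * ((r / 2 / 2) ^ d * unitBallMeasure d) =
        r ^ (d + 1) * (unitBallMeasure d / 4 ^ (d + 1)) := by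
      rw [div_div, div_pow]
      norm_num
      field_simp
      ring
    rw [h1, mul_left_comm] at hdens
    have h2 := le_of_mul_le_mul_left hdens (by positivity)
    refine le_trans (mul_le_mul_of_nonneg_left ((lowerConst_le hd).trans ?_) hpos) h2
    have := unitBallMeasure_pos (d := d)
    gcongr
    norm_num
  have hpow : c₂ * (1 + matNorm a) ^ d ≤ c₂ + c₁ * (2 ^ d * matNorm a) := by
    have h1 := mul_le_mul_of_nonneg_left (one_add_pow_le d hA hA1) hc₂
    have h2 := mul_le_mul_of_nonneg_right hc (by positivity : 0 ≤ 2 ^ d * matNorm a)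
    have h3 := mul_nonneg hc₂ hA
    linarith
  have h3 := mul_le_mul_of_nonneg_left hpow hk.le
  have h4 := mul_le_mul_of_nonneg_left hmat2 (by positivity : (0 : ℝ) ≤ 2 ^ d)
  rw [pow_succ]
  linarith

end Estimates

/-- With `P₁ = ℝ^d × {0}`, `P₂ = {(x,xa+b)}`, flat measures
`μᵢ = cᵢ μ_{Pᵢ}`, `c₂ ≤ c₁`, both planes meeting `B(x₀,r/2)`, `x₀ ∈ B(0,r/2)`:
if `|a| ≤ 1` then `dist_{x₀,r}(μ₁,μ₂) ≥ C⁻¹ [c₁(|a| + |b|/r) + (c₁ − c₂)]`, and if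
`|a| ≥ 1` then `dist_{x₀,r}(μ₁,μ₂) ≥ C⁻¹ c₁`, with `C = C(n,d)`. -/
theorem stmt15 (d m : ℕ) (hd : 0 < d) (hm : 0 < m) :
    ∃ C > 0, ∀ (a : Fin d → Fin m → ℝ) (b : Fin m → ℝ) (c₁ c₂ : ℝ)
      (x₀ : EuclideanSpace ℝ (Fin (d + m))) (r : ℝ)
      (μ₁ μ₂ : Measure (EuclideanSpace ℝ (Fin (d + m)))),
      0 < r → 0 < c₂ → c₂ ≤ c₁ → x₀ ∈ ball (0 : EuclideanSpace ℝ (Fin (d + m))) (r / 2) →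
      (graphPlane d m 0 0 ∩ ball x₀ (r / 2)).Nonempty →
      (graphPlane d m a b ∩ ball x₀ (r / 2)).Nonempty →
      μ₁ = ENNReal.ofReal c₁ • (μH[(d : ℝ)]).restrict (graphPlane d m 0 0) →
      μ₂ = ENNReal.ofReal c₂ • (μH[(d : ℝ)]).restrict (graphPlane d m a b) →
      (matNorm a ≤ 1 →
        C⁻¹ * (c₁ * (matNorm a + vecNorm b / r) + (c₁ - c₂)) ≤ wdist d x₀ r μ₁ μ₂) ∧
      (1 ≤ matNorm a → C⁻¹ * c₁ ≤ wdist d x₀ r μ₁ μ₂) := by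
  have hk := lowerConst_pos hd
  refine ⟨(11 + 2 ^ (d + 1)) / lowerConst d, by positivity, ?_⟩
  intro a b c₁ c₂ x₀ r μ₁ μ₂ hr hc₂ hc hx₀ h₁ h₂ hμ₁ hμ₂
  change μ₁ = flatMeasure c₁ 0 0 at hμ₁
  change μ₂ = flatMeasure c₂ a b at hμ₂
  subst hμ₁ hμ₂
  have hc₁ := hc₂.le.trans hc
  obtain ⟨_, hp, hpb⟩ := h₁
  rw [← range_graphMap] at hp
  obtain ⟨p, rfl⟩ := hp
  have hA := matNorm_nonneg a
  have hmat := mul_matNorm_le_wdist (a := a) (b := b) (c₂ := c₂) hd hr hc₁ hpb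
  set D := wdist d x₀ r (flatMeasure c₁ 0 0) (flatMeasure c₂ a b) with hDdef
  have hD : 0 ≤ D :=
    nonneg_of_mul_nonneg_right ((by positivity : (0 : ℝ) ≤ _).trans hmat) (by positivity)
  have hpow : (0 : ℝ) < 2 ^ (d + 1) := by positivity
  constructor
  · intro hA1
    have hvec := mul_vecNorm_le_wdist (c₂ := c₂) hd hr hc₁ hA1 hpb hx₀ h₂
    have hsub := mul_sub_le_wdist (b := b) hd hr hc₂.le hc hA1 hpb
    rw [← hDdef] at hvec hsub
    rw [inv_div, div_mul_eq_mul_div, div_le_iff₀ (by positivity)]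
    nlinarith
  · intro hA1
    rw [inv_div, div_mul_eq_mul_div, div_le_iff₀ (by positivity)]
    have h1 : matNorm a * (lowerConst d * c₁) ≤ matNorm a * (2 * D) := by nlinarith
    have h2 := le_of_mul_le_mul_left h1 (by linarith)
    nlinarith
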